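/- arXiv:1411.5635 — 2 statements merged into one kernel-verified Lean document; each statement's English description precedes it below -/
import Mathlib

section
/- Let P be a consistent logic program, E a stable extension of the translated ABA framework ABA_P, and A an argument not contained in E. For every negative Attack Tree attTree_E^−(A) of A with respect to E, the subtree of the translated abstract dispute tree T_E(A) rooted at A_i, where A_i^+ is the only child of the root A^− in attTree_E^−(A), is an admissible abstract dispute tree. -/
/-! ### Logic programs with negation-as-failure -/

/-- A classical literal over atoms `α`: `(true, a)` is the atom `a`,
`(false, a)` is the classically negated atom `¬ a`. -/
abbrev CLit (α : Type) := Bool × α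

/-- A general literal: a classical literal or a NAF literal `not l`. -/
inductive GLit (α : Type) where
  | cl (l : CLit α)
  | naf (l : CLit α)

/-- A clause `head ← pos₁,...,posₘ, not naf₁,..., not nafₙ`. -/
structure LPClause (α : Type) where
  head : CLit α
  pos : List (CLit α)
  naf : List (CLit α)

/-- A logic program: a set of clauses. -/
abbrev LogicProgram (α : Type) := Set (LPClause α)

/-- The Herbrand base of `P`: the atoms occurring in `P`. -/
def herbrand {α : Type} (P : LogicProgram α) : Set α :=
  {a | ∃ C ∈ P, C.head.2 = a ∨ (∃ l ∈ C.pos, l.2 = a) ∨ (∃ l ∈ C.naf, l.2 = a)}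

/-- `Lit_P` : all classical literals of `P`. -/
def litsOf {α : Type} (P : LogicProgram α) : Set (CLit α) := {l | l.2 ∈ herbrand P}

/-- `Δ_S = {not l ∈ NAF_P | l ∉ S}`, represented by the set of classical
literals `l` such that `not l ∈ Δ_S`. -/
def deltaOf {α : Type} (P : LogicProgram α) (S : Set (CLit α)) : Set (CLit α) :=
  {l | l ∈ litsOf P ∧ l ∉ S}

/-- `P ∪ Δ ⊢_MP k` : derivability by modus ponens on `←` from `P` together with
the NAF facts `{not l ← | not l ∈ Δ}`, treating NAF literals purely syntactically. -/
inductive DerivesMP {α : Type} (P : LogicProgram α) (Δ : Set (CLit α)) : GLit α → Prop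
  | nafFact {l : CLit α} : l ∈ Δ → DerivesMP P Δ (GLit.naf l)
  | mp {C : LPClause α} : C ∈ P → (∀ l ∈ C.pos, DerivesMP P Δ (GLit.cl l)) →
      (∀ l ∈ C.naf, DerivesMP P Δ (GLit.naf l)) → DerivesMP P Δ (GLit.cl C.head)

/-- The least set of classical literals closed under the clauses of a
(NAF-free) program. -/
def minClosed {α : Type} (P : LogicProgram α) : Set (CLit α) :=
  {l | DerivesMP P ∅ (GLit.cl l)}

/-- The answer set `AS(P)` of a NAF-free program `P`: the smallest `S ⊆ Lit_P`
closed under the clauses of `P`, which equals `Lit_P` in case it contains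
complementary classical literals `a` and `¬ a`. -/
def posAnswerSet {α : Type} (P : LogicProgram α) : Set (CLit α) :=
  minClosed P ∪
    {l | l ∈ litsOf P ∧ ∃ a : α, (true, a) ∈ minClosed P ∧ (false, a) ∈ minClosed P}

/-- The reduct `P^S`: delete every clause containing some `not l` with `l ∈ S`,
and delete all NAF literals from the remaining clauses. -/
def reduct {α : Type} (P : LogicProgram α) (S : Set (CLit α)) : LogicProgram α :=
  {C' | ∃ C ∈ P, (∀ l ∈ C.naf, l ∉ S) ∧ C' = LPClause.mk C.head C.pos []}

/-- `S` is an answer set of `P`: `S ⊆ Lit_P` and `S = AS(P^S)`. -/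
def IsAnswerSet {α : Type} (P : LogicProgram α) (S : Set (CLit α)) : Prop :=
  S ⊆ litsOf P ∧ S = posAnswerSet (reduct P S)

/-- `P` is consistent: it has an answer set different from `Lit_P`. -/
def LPConsistent {α : Type} (P : LogicProgram α) : Prop :=
  ∃ S, IsAnswerSet P S ∧ S ≠ litsOf P

/-- `S_NAF = S ∪ Δ_S`, as a set of general literals. -/
def withNaf {α : Type} (P : LogicProgram α) (S : Set (CLit α)) : Set (GLit α) :=
  (GLit.cl '' S) ∪ (GLit.naf '' deltaOf P S)

/-- `T` is an answer set with NAF literals of `P`. -/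
def IsAnswerSetNAF {α : Type} (P : LogicProgram α) (T : Set (GLit α)) : Prop :=
  ∃ S, IsAnswerSet P S ∧ T = withNaf P S

/-! ### ABA frameworks -/

/-- An inference rule `head ← body₁,...,bodyₘ`. -/
structure ABARule (L : Type) where
  head : L
  body : List L

/-- An ABA framework `⟨L, R, A, ¯⟩` (the language is the type `L`). -/
structure ABAFramework (L : Type) where
  rules : Set (ABARule L)
  assumptions : Set L
  contrary : L → L

/-- A flat ABA framework: no assumption is the head of a rule. -/
def ABAFlat {L : Type} (F : ABAFramework L) : Prop :=
  ∀ r ∈ F.rules, r.head ∉ F.assumptions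

/-- `s` is a fact of `F`, i.e. `s ← ∈ R`. -/
def IsFact {L : Type} (F : ABAFramework L) (s : L) : Prop :=
  ABARule.mk s [] ∈ F.rules

/-- Finite trees whose nodes hold sentences of `L`. -/
inductive ABATree (L : Type) where
  | leaf (s : L)
  | node (s : L) (children : List (ABATree L))

/-- The sentence held by the root of a tree (the conclusion). -/
def ABATree.concl {L : Type} : ABATree L → L
  | .leaf s => s
  | .node s _ => s

/-- `ABALeaf s u`: the sentence `s` is held by some leaf of the tree `u`. -/
inductive ABALeaf {L : Type} : L → ABATree L → Prop
  | leaf (s : L) : ABALeaf s (.leaf s)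
  | node {s x : L} {u : ABATree L} {cs : List (ABATree L)} :
      u ∈ cs → ABALeaf x u → ABALeaf x (.node s cs)

/-- Well-formed argument trees of `F`: every leaf holds an assumption or a fact,
and every non-leaf node holding `γ₀` has children `γ₁,...,γₘ` (`m > 0`) for some
rule `γ₀ ← γ₁,...,γₘ` of `F`. -/
inductive ABAWf {L : Type} (F : ABAFramework L) : ABATree L → Prop
  | leaf_asm {s : L} : s ∈ F.assumptions → ABAWf F (.leaf s)
  | leaf_fact {s : L} : IsFact F s → ABAWf F (.leaf s)
  | node {s : L} {cs : List (ABATree L)} : cs ≠ [] →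
      ABARule.mk s (cs.map ABATree.concl) ∈ F.rules →
      (∀ u ∈ cs, ABAWf F u) → ABAWf F (.node s cs)

/-- The assumption-premises of a tree: all assumptions held by leaves. -/
def APofTree {L : Type} (F : ABAFramework L) (u : ABATree L) : Set L :=
  {s | ABALeaf s u ∧ s ∈ F.assumptions}

/-- The fact-premises of a tree: all facts held by leaves. -/
def FPofTree {L : Type} (F : ABAFramework L) (u : ABATree L) : Set L :=
  {s | ABALeaf s u ∧ IsFact F s}

/-- An argument of `F`: a well-formed argument tree. -/
structure ABAArg {L : Type} (F : ABAFramework L) where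
  tree : ABATree L
  wf : ABAWf F tree

/-- The conclusion of an argument. -/
def ABAArg.concl {L : Type} {F : ABAFramework L} (A : ABAArg F) : L := A.tree.concl

/-- The assumption-premises `AP` of an argument. -/
def ABAArg.AP {L : Type} {F : ABAFramework L} (A : ABAArg F) : Set L :=
  APofTree F A.tree

/-- The fact-premises `FP` of an argument. -/
def ABAArg.FP {L : Type} {F : ABAFramework L} (A : ABAArg F) : Set L :=
  FPofTree F A.tree

/-- `(AP, FP) ⊢ a` is an argument in `F`. -/
def IsArgument {L : Type} (F : ABAFramework L) (AP FP : Set L) (a : L) : Prop :=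
  ∃ u : ABATree L, ABAWf F u ∧ u.concl = a ∧ APofTree F u = AP ∧ FPofTree F u = FP

/-- `A` attacks `B` (on some assumption-premise of `B`). -/
def Attacks {L : Type} {F : ABAFramework L} (A B : ABAArg F) : Prop :=
  ∃ b ∈ ABAArg.AP B, F.contrary b = ABAArg.concl A

/-- A set of arguments `X` attacks an argument `B`. -/
def SetAttacks {L : Type} {F : ABAFramework L} (X : Set (ABAArg F)) (B : ABAArg F) : Prop :=
  ∃ A ∈ X, Attacks A B

/-- `X` is a stable extension of `F`: `X` does not attack itself and attacks
every argument not belonging to `X`. -/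
def IsStableExt {L : Type} {F : ABAFramework L} (X : Set (ABAArg F)) : Prop :=
  (∀ B ∈ X, ¬ SetAttacks X B) ∧ ∀ B : ABAArg F, B ∉ X → SetAttacks X B

/-- `X` defends `A`: `X` attacks all attackers of `A`. -/
def Defends {L : Type} {F : ABAFramework L} (X : Set (ABAArg F)) (A : ABAArg F) : Prop :=
  ∀ B : ABAArg F, Attacks B A → SetAttacks X B

/-- `X` is an admissible extension of `F`. -/
def IsAdmissibleExt {L : Type} {F : ABAFramework L} (X : Set (ABAArg F)) : Prop :=
  (∀ B ∈ X, ¬ SetAttacks X B) ∧ ∀ A ∈ X, Defends X A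

/-- `R ∪ AP ⊢_MP a`: derivability by modus ponens from the rules `R`, treating
each member of `AP` as a fact. -/
inductive DerivesABA {L : Type} (R : Set (ABARule L)) (AP : Set L) : L → Prop
  | asm {s : L} : s ∈ AP → DerivesABA R AP s
  | mp {r : ABARule L} : r ∈ R → (∀ b ∈ r.body, DerivesABA R AP b) →
      DerivesABA R AP r.head

/-- The assumption-argument `({s}, ∅) ⊢ s` (resp. the fact-argument
`(∅, {s}) ⊢ s`), i.e. the one-node tree holding `s`, belongs to `X`. -/
def LeafArgMem {L : Type} {F : ABAFramework L} (X : Set (ABAArg F)) (s : L) : Prop :=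
  ∃ B ∈ X, B.tree = ABATree.leaf s

/-! ### The translated ABA framework of a logic program -/

/-- The translated ABA framework `ABA_P` of a logic program `P`:
rules are the clauses of `P` (with NAF literals as assumptions), assumptions
are `NAF_P`, and the contrary of `not l` is `l`. -/
def translateLP {α : Type} (P : LogicProgram α) : ABAFramework (GLit α) where
  rules := {r | ∃ C ∈ P,
    r = ABARule.mk (GLit.cl C.head) (C.pos.map GLit.cl ++ C.naf.map GLit.naf)}
  assumptions := {k | ∃ l ∈ litsOf P, k = GLit.naf l}
  contrary := fun k => match k with
    | GLit.cl l => GLit.cl l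
    | GLit.naf l => GLit.cl l

/-- `E` is the corresponding stable extension of the answer set `S`:
`E` is a stable extension of `ABA_P` and `S_NAF` is the set of conclusions of
arguments in `E`. -/
def CorrStableExt {α : Type} (P : LogicProgram α) (S : Set (CLit α))
    (E : Set (ABAArg (translateLP P))) : Prop :=
  IsStableExt E ∧ withNaf P S = {k | ∃ A ∈ E, ABAArg.concl A = k}

/-! ### Possibly infinite rooted labelled trees -/

/-- A (possibly infinite) rooted tree with nodes labelled by `β`: a type of
nodes with a parent function `par` fixing the root, such that every node
reaches the root by finitely many parent steps. -/
structure RTree (β : Type) where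
  N : Type
  root : N
  par : N → N
  label : N → β
  par_root : par root = root
  reaches : ∀ n : N, ∃ k : ℕ, par^[k] n = root

/-- The children of a node. -/
def RTree.children {β : Type} (t : RTree β) (n : t.N) : Set t.N :=
  {m | t.par m = n ∧ m ≠ t.root}

/-- A leaf node: a node without children. -/
def RTree.IsLeafNode {β : Type} (t : RTree β) (n : t.N) : Prop :=
  t.children n = ∅

theorem RTree.child_ne_root {β : Type} (t : RTree β) {m₀ : t.N}
    (h : t.children t.root = {m₀}) : m₀ ≠ t.root := by
  have hm : m₀ ∈ t.children t.root := by rw [h]; exact rfl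
  exact hm.2

theorem RTree.par_ne_root {β : Type} (t : RTree β) {m₀ : t.N}
    (h : t.children t.root = {m₀}) :
    ∀ n : t.N, n ≠ t.root → n ≠ m₀ → t.par n ≠ t.root := by
  intro n h1 h2 h3
  apply h2
  have hm : n ∈ t.children t.root := ⟨h3, h1⟩
  rwa [h, Set.mem_singleton_iff] at hm

open Classical in
/-- The parent function of the tree obtained by removing the root (whose unique
child is `m₀`). -/
noncomputable def RTree.delPar {β : Type} (t : RTree β) (m₀ : t.N)
    (hm₀ : m₀ ≠ t.root) (hp : ∀ n : t.N, n ≠ t.root → n ≠ m₀ → t.par n ≠ t.root) :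
    {n : t.N // n ≠ t.root} → {n : t.N // n ≠ t.root} := fun n =>
  if hn : n.1 = m₀ then ⟨m₀, hm₀⟩ else ⟨t.par n.1, hp n.1 n.2 hn⟩

/-- The subtree of `t` rooted at the unique child `m₀` of the root, obtained
from `t` by removing its root. -/
noncomputable def RTree.delRoot {β : Type} (t : RTree β) (m₀ : t.N)
    (h : t.children t.root = {m₀}) : RTree β where
  N := {n : t.N // n ≠ t.root}
  root := ⟨m₀, t.child_ne_root h⟩
  par := t.delPar m₀ (t.child_ne_root h) (t.par_ne_root h)
  label := fun n => t.label n.1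
  par_root := dif_pos rfl
  reaches := by
    have key : ∀ (k : ℕ) (n : t.N) (hn : n ≠ t.root), t.par^[k] n = t.root →
        ∃ j : ℕ, (t.delPar m₀ (t.child_ne_root h) (t.par_ne_root h))^[j] ⟨n, hn⟩ =
          ⟨m₀, t.child_ne_root h⟩ := by
      intro k
      induction k with
      | zero =>
        intro n hn h0
        simp only [Function.iterate_zero_apply] at h0
        exact absurd h0 hn
      | succ k ih =>
        intro n hn hk
        by_cases hm : n = m₀
        · refine ⟨0, ?_⟩
          simp only [Function.iterate_zero_apply]
          exact Subtype.ext hm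
        · have hpn : t.par n ≠ t.root := t.par_ne_root h n hn hm
          rw [Function.iterate_succ_apply] at hk
          obtain ⟨j, hj⟩ := ih (t.par n) hpn hk
          refine ⟨j + 1, ?_⟩
          rw [Function.iterate_succ_apply]
          have hstep : t.delPar m₀ (t.child_ne_root h) (t.par_ne_root h) ⟨n, hn⟩ =
              ⟨t.par n, hpn⟩ := dif_neg hm
          rw [hstep]
          exact hj
    rintro ⟨n, hn⟩
    obtain ⟨k, hk⟩ := t.reaches n
    exact key k n hn hk

/-! ### Attack Trees -/

/-- `t` is an Attack Tree of the argument `A` with respect to the set of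
arguments `X`.  Nodes hold arguments labelled `'+'` (`true`) or `'−'` (`false`). -/
structure IsAttackTree {L : Type} {F : ABAFramework L} (X : Set (ABAArg F))
    (A : ABAArg F) (t : RTree (ABAArg F × Bool)) : Prop where
  root_arg : (t.label t.root).1 = A
  root_lab : (t.label t.root).2 = true ↔ A ∈ X
  pos_complete : ∀ n : t.N, (t.label n).2 = true →
      ∀ B : ABAArg F, Attacks B (t.label n).1 →
        ∃ m ∈ t.children n, t.label m = (B, false)
  pos_sound : ∀ n : t.N, (t.label n).2 = true → ∀ m ∈ t.children n,
      (t.label m).2 = false ∧ Attacks (t.label m).1 (t.label n).1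
  neg_none : ∀ n : t.N, (t.label n).2 = false →
      (¬ ∃ B ∈ X, Attacks B (t.label n).1) → t.children n = ∅
  neg_one : ∀ n : t.N, (t.label n).2 = false →
      (∃ B ∈ X, Attacks B (t.label n).1) →
        ∃ m : t.N, t.children n = {m} ∧ (t.label m).2 = true ∧
          (t.label m).1 ∈ X ∧ Attacks (t.label m).1 (t.label n).1

/-- A positive Attack Tree: an Attack Tree whose root is labelled `'+'`. -/
def IsPosAttackTree {L : Type} {F : ABAFramework L} (X : Set (ABAArg F))
    (A : ABAArg F) (t : RTree (ABAArg F × Bool)) : Prop :=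
  IsAttackTree X A t ∧ (t.label t.root).2 = true

/-- A negative Attack Tree: an Attack Tree whose root is labelled `'−'`. -/
def IsNegAttackTree {L : Type} {F : ABAFramework L} (X : Set (ABAArg F))
    (A : ABAArg F) (t : RTree (ABAArg F × Bool)) : Prop :=
  IsAttackTree X A t ∧ (t.label t.root).2 = false

/-! ### Abstract dispute trees -/

/-- `t` is an abstract dispute tree for the argument `A`, where nodes labelled
`true` are proponent nodes and nodes labelled `false` are opponent nodes.
Under this encoding, the translated abstract dispute tree of an Attack Tree is
the Attack Tree itself (proponent = `'+'`, opponent = `'−'`). -/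
structure IsDisputeTree {L : Type} {F : ABAFramework L} (A : ABAArg F)
    (t : RTree (ABAArg F × Bool)) : Prop where
  root_lab : t.label t.root = (A, true)
  prop_complete : ∀ n : t.N, (t.label n).2 = true →
      ∀ B : ABAArg F, Attacks B (t.label n).1 →
        ∃ m ∈ t.children n, t.label m = (B, false)
  prop_sound : ∀ n : t.N, (t.label n).2 = true → ∀ m ∈ t.children n,
      (t.label m).2 = false ∧ Attacks (t.label m).1 (t.label n).1
  opp_one : ∀ n : t.N, (t.label n).2 = false →
      ∃ m : t.N, t.children n = {m} ∧ (t.label m).2 = true ∧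
        Attacks (t.label m).1 (t.label n).1

/-- An abstract dispute tree is admissible: no argument labels both a
proponent and an opponent node. -/
def AdmissibleDT {L : Type} {F : ABAFramework L} (t : RTree (ABAArg F × Bool)) : Prop :=
  ∀ n m : t.N, (t.label n).2 = true → (t.label m).2 = false →
    (t.label n).1 ≠ (t.label m).1
/-- Induction along the edges of a rooted tree, from the root downwards. -/
theorem RTree.induction_on_par {β : Type} (t : RTree β) {p : t.N → Prop} (root : p t.root)
    (child : ∀ n, ∀ m ∈ t.children n, p n → p m) (n : t.N) : p n := by
  obtain ⟨k, hk⟩ := t.reaches n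
  induction k generalizing n with
  | zero =>
    obtain rfl : n = t.root := hk
    exact root
  | succ k ih =>
    by_cases hn : n = t.root
    · exact hn ▸ root
    · exact child (t.par n) n ⟨rfl, hn⟩ (ih (t.par n) hk)

theorem RTree.mem_children_delRoot {β : Type} (t : RTree β) {m₀ : t.N}
    (h : t.children t.root = {m₀}) (n m : {n : t.N // n ≠ t.root}) :
    m ∈ (t.delRoot m₀ h).children n ↔ m.1 ∈ t.children n.1 := by
  have hpar : t.par m₀ = t.root := by
    have hm : m₀ ∈ t.children t.root := h ▸ rfl
    exact hm.1
  change t.delPar m₀ (t.child_ne_root h) (t.par_ne_root h) m = n ∧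
    m ≠ ⟨m₀, t.child_ne_root h⟩ ↔ t.par m.1 = n.1 ∧ m.1 ≠ t.root
  by_cases hm : m.1 = m₀
  · refine iff_of_false (fun h' => h'.2 (Subtype.ext hm)) fun h' => n.2 ?_
    rw [← h'.1, hm, hpar]
  · have hstep : t.delPar m₀ (t.child_ne_root h) (t.par_ne_root h) m =
        ⟨t.par m.1, t.par_ne_root h m.1 m.2 hm⟩ := dif_neg hm
    rw [hstep, Subtype.ext_iff]
    exact and_congr_right fun _ =>
      iff_of_true (fun h' => hm (congrArg Subtype.val h')) m.2

/-- In an Attack Tree with respect to a stable extension, the nodes labelled `'+'` are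
exactly those holding a member of the extension. -/
theorem IsAttackTree.label_eq_true_iff {L : Type} {F : ABAFramework L} {X : Set (ABAArg F)}
    (hX : IsStableExt X) {A : ABAArg F} {t : RTree (ABAArg F × Bool)}
    (ht : IsAttackTree X A t) (n : t.N) : (t.label n).2 = true ↔ (t.label n).1 ∈ X := by
  induction n using t.induction_on_par with
  | root => rw [ht.root_lab, ht.root_arg]
  | child n m hm ih =>
    cases hn : (t.label n).2 with
    | true =>
      obtain ⟨hfalse, hatt⟩ := ht.pos_sound n hn m hm
      have hnot : (t.label m).1 ∉ X := fun h => hX.1 _ (ih.1 hn) ⟨_, h, hatt⟩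
      simp [hfalse, hnot]
    | false =>
      have hnot : (t.label n).1 ∉ X := fun h => by simp [ih.2 h] at hn
      obtain ⟨m', hc, htrue, hmem, -⟩ := ht.neg_one n hn (hX.2 _ hnot)
      obtain rfl : m = m' := by rwa [hc] at hm
      exact iff_of_true htrue hmem

/-- For `A ∉ E` and any negative Attack Tree of `A` w.r.t. the
stable extension `E`, the subtree of the translated abstract dispute tree
rooted at the unique child `A_i⁺` of the root is an admissible abstract
dispute tree (proponent = `'+'`, opponent = `'−'`). -/
theorem neg_attack_tree_subtree_admissible_dispute_tree {α : Type}
    (P : LogicProgram α) (hP : LPConsistent P)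
    (E : Set (ABAArg (translateLP P))) (hE : IsStableExt E)
    (A : ABAArg (translateLP P)) (hA : A ∉ E)
    (t : RTree (ABAArg (translateLP P) × Bool)) (ht : IsNegAttackTree E A t)
    (m₀ : t.N) (hm : t.children t.root = {m₀}) (hpos : (t.label m₀).2 = true) :
    IsDisputeTree (t.label m₀).1 (t.delRoot m₀ hm) ∧
      AdmissibleDT (t.delRoot m₀ hm) := by
  have key := ht.1.label_eq_true_iff hE
  refine ⟨⟨Prod.ext rfl hpos, ?_, ?_, ?_⟩, ?_⟩
  · rintro ⟨n, hn⟩ hlab B hB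
    obtain ⟨m, hmem, hmB⟩ := ht.1.pos_complete n hlab B hB
    exact ⟨⟨m, hmem.2⟩, (t.mem_children_delRoot hm ⟨n, hn⟩ ⟨m, hmem.2⟩).2 hmem, hmB⟩
  · intro n hlab m hmem
    exact ht.1.pos_sound n.1 hlab m.1 ((t.mem_children_delRoot hm n m).1 hmem)
  · intro n hlab
    have hnot : (t.label n.1).1 ∉ E := fun h =>
      Bool.false_ne_true (hlab.symm.trans ((key n.1).2 h))
    obtain ⟨m, hc, htrue, -, hatt⟩ := ht.1.neg_one n.1 hlab (hE.2 _ hnot)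
    have hmem : m ∈ t.children n.1 := hc ▸ rfl
    refine ⟨⟨m, hmem.2⟩, Set.ext fun x => (t.mem_children_delRoot hm n x).trans ?_, htrue, hatt⟩
    rw [hc]
    exact ⟨fun hx => Subtype.ext hx, fun hx => congrArg Subtype.val hx⟩
  · intro n m hn hm' heq
    have hmem : (t.label m.1).1 ∈ E := heq ▸ (key n.1).1 hn
    exact Bool.false_ne_true (hm'.symm.trans ((key m.1).2 hmem))
end

section
/- Let P be a consistent logic program, E a stable extension of the translated ABA framework ABA_P, and attTree_E^−(A) a negative Attack Tree of some argument A in ABA_P with respect to E. Then the set Args of all arguments labelled '+' in attTree_E^−(A) is an admissible extension of ABA_P, and Args ⊆ E. -/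
/-- In a negative Attack Tree with respect to `X`, every argument labelled `'+'` belongs to `X`. -/
theorem IsNegAttackTree.mem_of_label_true {L : Type} {F : ABAFramework L} {X : Set (ABAArg F)}
    {A : ABAArg F} {t : RTree (ABAArg F × Bool)} (ht : IsNegAttackTree X A t) {n : t.N}
    (hn : (t.label n).2 = true) : (t.label n).1 ∈ X := by
  obtain ⟨ht, hroot⟩ := ht
  have hne : n ≠ t.root := by
    rintro rfl
    simp [hroot] at hn
  have hmem : n ∈ t.children (t.par n) := ⟨rfl, hne⟩
  have hpar : (t.label (t.par n)).2 = false := by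
    by_contra hp
    have hneg := (ht.pos_sound _ (by simpa using hp) n hmem).1
    simp [hneg] at hn
  have hatt : ∃ B ∈ X, Attacks B (t.label (t.par n)).1 := by
    by_contra h
    rw [ht.neg_none _ hpar h] at hmem
    exact hmem
  obtain ⟨m, hm, -, hmX, -⟩ := ht.neg_one _ hpar hatt
  rw [hm, Set.mem_singleton_iff] at hmem
  rwa [hmem]

/-- In an Attack Tree with respect to a stable extension `X`, the set of arguments labelled `'+'`
defends each of its members that lies in `X`. -/
theorem IsAttackTree.defends_of_mem {L : Type} {F : ABAFramework L} {X : Set (ABAArg F)}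
    {A : ABAArg F} {t : RTree (ABAArg F × Bool)} (ht : IsAttackTree X A t) (hX : IsStableExt X)
    {n : t.N} (hn : (t.label n).2 = true) (hnX : (t.label n).1 ∈ X) :
    Defends {B : ABAArg F | ∃ n : t.N, t.label n = (B, true)} (t.label n).1 := by
  intro B hB
  obtain ⟨m, -, hm⟩ := ht.pos_complete n hn B hB
  have hBX : B ∉ X := fun h => hX.1 _ hnX ⟨B, h, hB⟩
  obtain ⟨k, -, hk, -, hatt⟩ := ht.neg_one m (by rw [hm]) (by rw [hm]; exact hX.2 B hBX)
  rw [hm] at hatt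
  exact ⟨(t.label k).1, ⟨k, Prod.ext rfl hk⟩, hatt⟩

/-- The set of all arguments labelled `'+'` in a negative Attack
Tree w.r.t. a stable extension `E` of `ABA_P` is an admissible extension of
`ABA_P` and a subset of `E`. -/
theorem neg_attack_tree_plus_args_admissible {α : Type} (P : LogicProgram α)
    (hP : LPConsistent P)
    (E : Set (ABAArg (translateLP P))) (hE : IsStableExt E)
    (A : ABAArg (translateLP P)) (t : RTree (ABAArg (translateLP P) × Bool))
    (ht : IsNegAttackTree E A t) :
    IsAdmissibleExt {B : ABAArg (translateLP P) | ∃ n : t.N, t.label n = (B, true)} ∧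
      {B : ABAArg (translateLP P) | ∃ n : t.N, t.label n = (B, true)} ⊆ E := by
  have hsub : {B : ABAArg (translateLP P) | ∃ n : t.N, t.label n = (B, true)} ⊆ E := by
    rintro B ⟨n, hn⟩
    simpa [hn] using ht.mem_of_label_true (n := n) (by rw [hn])
  refine ⟨⟨?_, ?_⟩, hsub⟩
  · rintro B hB ⟨C, hC, hCB⟩
    exact hE.1 B (hsub hB) ⟨C, hsub hC, hCB⟩
  · rintro B ⟨n, hn⟩
    have hlab : (t.label n).2 = true := by rw [hn]
    simpa only [hn] using ht.1.defends_of_mem hE hlab (ht.mem_of_label_true hlab)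
end
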